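/- For the c-form ω_k = k · (dx/x) ∧ (dy/y) on ℝ² (k > 0 real) with Z the union of the two coordinate axes, the principal-value integral lim_{ε→0} ∫_{|x|≥ε, |y|≥ε, (x,y)∈[-1,1]²} k φ(x,y)/(xy) dx dy over any smooth compactly supported bump φ with φ ≡ 1 near the origin determines k: if ω_k and ω_{k'} induce the same functional on such test forms up to exact corrections, then k = k'. In particular, for k ≠ k' there is no diffeomorphism of ℝ² preserving the coordinate cross Z that pulls back ω_{k'} to ω_k. -/

import Mathlib

open MeasureTheory

/-- The principal-value pairing of the `c`-form `ω_k = k (dx/x) ∧ (dy/y)` with a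
test function `φ`, at cutoff `ε`. -/
noncomputable def pvPairing (k : ℝ) (φ : ℝ × ℝ → ℝ) (ε : ℝ) : ℝ :=
  ∫ z in {z : ℝ × ℝ | z ∈ Set.Icc ((-1, -1) : ℝ × ℝ) ((1, 1) : ℝ × ℝ) ∧
      ε ≤ |z.1| ∧ ε ≤ |z.2|},
    k * φ z / (z.1 * z.2)

/-- The coordinate cross `Z = {x = 0} ∪ {y = 0} ⊆ ℝ²`. -/
def crossZ : Set (ℝ × ℝ) := {z : ℝ × ℝ | z.1 = 0 ∨ z.2 = 0}

open Filter Topology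

/-- The principal-value pairing of a tensor product `g ⊗ g` is `k` times a square. -/
lemma pvPairing_mul_self (k : ℝ) (g : ℝ → ℝ) (ε : ℝ) :
    pvPairing k (fun z => g z.1 * g z.2) ε =
      k * (∫ x in {x : ℝ | x ∈ Set.Icc (-1 : ℝ) 1 ∧ ε ≤ |x|}, g x / x) ^ 2 := by
  have hS : {z : ℝ × ℝ | z ∈ Set.Icc ((-1, -1) : ℝ × ℝ) ((1, 1) : ℝ × ℝ) ∧
      ε ≤ |z.1| ∧ ε ≤ |z.2|} =
      {x : ℝ | x ∈ Set.Icc (-1 : ℝ) 1 ∧ ε ≤ |x|} ×ˢ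
        {x : ℝ | x ∈ Set.Icc (-1 : ℝ) 1 ∧ ε ≤ |x|} := by
    ext ⟨x, y⟩
    simp only [Set.mem_ofPred_eq, Set.mem_Icc, Prod.mk_le_mk, Set.mem_prod]
    tauto
  have hf (z : ℝ × ℝ) : k * (g z.1 * g z.2) / (z.1 * z.2) = k * (g z.1 / z.1 * (g z.2 / z.2)) := by
    rw [mul_div_assoc, mul_div_mul_comm]
  simp only [pvPairing, hf]
  rw [integral_const_mul, hS, Measure.volume_eq_prod,
    setIntegral_prod_mul (fun x : ℝ => g x / x) (fun x : ℝ => g x / x), sq]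

lemma measurableSet_cutoff (ε : ℝ) :
    MeasurableSet {x : ℝ | x ∈ Set.Icc (-1 : ℝ) 1 ∧ ε ≤ |x|} :=
  measurableSet_Icc.inter (measurableSet_le measurable_const continuous_abs.measurable)

/-- The truncated principal-value integral of an even function against `dx/x` vanishes. -/
lemma setIntegral_cutoff_div_eq_zero_of_even {f : ℝ → ℝ} (hf : ∀ x, f (-x) = f x) (ε : ℝ) :
    ∫ x in {x : ℝ | x ∈ Set.Icc (-1 : ℝ) 1 ∧ ε ≤ |x|}, f x / x = 0 := by
  rw [← integral_indicator (measurableSet_cutoff ε)]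
  refine self_eq_neg.1 ?_
  rw [← integral_neg, ← integral_neg_eq_self]
  congr 1 with x
  have hx : -x ∈ {x : ℝ | x ∈ Set.Icc (-1 : ℝ) 1 ∧ ε ≤ |x|} ↔
      x ∈ {x : ℝ | x ∈ Set.Icc (-1 : ℝ) 1 ∧ ε ≤ |x|} := by
    simp only [Set.mem_ofPred_eq, Set.mem_Icc, abs_neg]
    constructor <;> rintro ⟨⟨h1, h2⟩, h3⟩ <;> exact ⟨⟨by linarith, by linarith⟩, h3⟩
  by_cases h : x ∈ {x : ℝ | x ∈ Set.Icc (-1 : ℝ) 1 ∧ ε ≤ |x|}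
  · rw [Set.indicator_of_mem (hx.2 h), Set.indicator_of_mem h, hf, div_neg]
  · rw [Set.indicator_of_notMem (mt hx.1 h), Set.indicator_of_notMem h, neg_zero]

/-- There is a one-dimensional cutoff function whose principal value against `dx/x` is nonzero. -/
lemma exists_cutoff_principalValue_ne_zero :
    ∃ (g : ℝ → ℝ) (c : ℝ), ContDiff ℝ (⊤ : ℕ∞) g ∧ HasCompactSupport g ∧
      (∀ᶠ x in 𝓝 (0 : ℝ), g x = 1) ∧ c ≠ 0 ∧
      ∀ ε ∈ Set.Ioo (0 : ℝ) (1 / 4),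
        ∫ x in {x : ℝ | x ∈ Set.Icc (-1 : ℝ) 1 ∧ ε ≤ |x|}, g x / x = c := by
  let f : ContDiffBump (0 : ℝ) := ⟨1 / 2, 1, by norm_num, by norm_num⟩
  let h : ContDiffBump (1 / 2 : ℝ) := ⟨1 / 8, 1 / 4, by norm_num, by norm_num⟩
  have hsupp : ∀ x, h x ≠ 0 → 1 / 4 < x ∧ x < 3 / 4 := by
    intro x hx
    have hmem : x ∈ Metric.ball (1 / 2 : ℝ) (1 / 4) := h.support_eq ▸ hx
    rw [Real.ball_eq_Ioo] at hmem
    constructor <;> linarith [hmem.1, hmem.2]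
  have hcont : Continuous fun x => h x / x := by
    have heq : (fun x => h x / x) = fun x => h x / max x (1 / 4) := by
      ext x
      by_cases hx : h x = 0
      · simp [hx]
      · rw [max_eq_left (hsupp x hx).1.le]
    rw [heq]
    exact h.continuous.div (by fun_prop) fun x => (lt_max_of_lt_right (by norm_num)).ne'
  have hcomp : HasCompactSupport fun x => h x / x := by
    simp only [div_eq_mul_inv]
    exact h.hasCompactSupport.mul_right
  have hint : Integrable fun x => h x / x := hcont.integrable_of_hasCompactSupport hcomp
  have hpos : 0 < ∫ x, h x / x := by
    refine hcont.integral_pos_of_hasCompactSupport_nonneg_nonzero hcomp (fun x => ?_)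
      (x := 1 / 2) ?_
    · by_cases hx : h x = 0
      · simp [hx]
      · exact div_nonneg h.nonneg (by linarith [(hsupp x hx).1])
    · exact div_ne_zero (h.pos_of_mem_ball (Metric.mem_ball_self h.rOut_pos)).ne' (by norm_num)
  refine ⟨fun x => f x + h x, ∫ x, h x / x, f.contDiff.add h.contDiff,
    f.hasCompactSupport.add h.hasCompactSupport, ?_, hpos.ne', ?_⟩
  · filter_upwards [f.eventuallyEq_one, Iio_mem_nhds (show (0 : ℝ) < 1 / 4 by norm_num)]
      with x hx hx'
    have hx0 : h x = 0 := by
      by_contra hne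
      exact absurd (hsupp x hne).1 (not_lt.2 (le_of_lt hx'))
    simp [hx, hx0]
  · rintro ε ⟨hε, hε'⟩
    have hfint : IntegrableOn (fun x => f x / x)
        {x : ℝ | x ∈ Set.Icc (-1 : ℝ) 1 ∧ ε ≤ |x|} := by
      have hK : IsCompact {x : ℝ | x ∈ Set.Icc (-1 : ℝ) 1 ∧ ε ≤ |x|} :=
        isCompact_Icc.inter_right (isClosed_le continuous_const continuous_abs)
      refine ContinuousOn.integrableOn_compact hK
        (f.continuous.continuousOn.div continuousOn_id fun x hx => ?_)
      exact abs_pos.1 (hε.trans_le hx.2)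
    simp only [add_div]
    rw [integral_add hfint hint.integrableOn,
      setIntegral_cutoff_div_eq_zero_of_even (fun x => f.neg x) ε, zero_add]
    refine setIntegral_eq_integral_of_forall_compl_eq_zero fun x hx => ?_
    by_contra hne
    have hx0 := hsupp x fun h0 => hne (by simp [h0])
    exact hx ⟨⟨by linarith, by linarith⟩, by rw [abs_of_pos] <;> linarith⟩

/-- A bump function whose principal value against `(dx/x) ∧ (dy/y)` is nonzero. -/
lemma exists_bump_tendsto_pvPairing :
    ∃ (φ : ℝ × ℝ → ℝ) (c : ℝ), ContDiff ℝ (⊤ : ℕ∞) φ ∧ HasCompactSupport φ ∧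
      (∀ᶠ z in 𝓝 (0 : ℝ × ℝ), φ z = 1) ∧ c ≠ 0 ∧
      ∀ k, Tendsto (pvPairing k φ) (𝓝[>] 0) (𝓝 (k * c)) := by
  obtain ⟨g, c, hg, hgc, hg1, hc, hgε⟩ := exists_cutoff_principalValue_ne_zero
  refine ⟨fun z => g z.1 * g z.2, c ^ 2, (hg.comp contDiff_fst).mul (hg.comp contDiff_snd), ?_, ?_,
    pow_ne_zero 2 hc, fun k => ?_⟩
  · refine HasCompactSupport.intro (hgc.isCompact.prod hgc.isCompact) fun z hz => ?_
    rw [Set.mem_prod, not_and_or] at hz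
    rcases hz with hz | hz
    · simp [image_eq_zero_of_notMem_tsupport hz]
    · simp [image_eq_zero_of_notMem_tsupport hz]
  · filter_upwards [(continuous_fst.tendsto (0 : ℝ × ℝ)).eventually hg1,
      (continuous_snd.tendsto (0 : ℝ × ℝ)).eventually hg1] with z h1 h2
    rw [h1, h2, one_mul]
  · refine tendsto_const_nhds.congr' ?_
    filter_upwards [Ioo_mem_nhdsGT (show (0 : ℝ) < 1 / 4 by norm_num)] with ε hε
    rw [pvPairing_mul_self, hgε ε hε]

/-- If `Φ` has a smooth left inverse, its Jacobian determinant does not vanish. -/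
lemma jacobian_ne_zero_of_leftInverse {Φ Ψ : ℝ × ℝ → ℝ × ℝ} (hΦ : Differentiable ℝ Φ)
    (hΨ : Differentiable ℝ Ψ) (h : ∀ z, Ψ (Φ z) = z) (z : ℝ × ℝ) :
    (fderiv ℝ Φ z (1, 0)).1 * (fderiv ℝ Φ z (0, 1)).2
      - (fderiv ℝ Φ z (1, 0)).2 * (fderiv ℝ Φ z (0, 1)).1 ≠ 0 := by
  set A := fderiv ℝ Φ z with hA
  have hinv : ∀ u, fderiv ℝ Ψ (Φ z) (A u) = u := by
    intro u
    have hcomp := ((hΨ (Φ z)).hasFDerivAt.comp z (hΦ z).hasFDerivAt)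
    rw [show Ψ ∘ Φ = id from funext h] at hcomp
    exact DFunLike.congr_fun (hcomp.unique (hasFDerivAt_id z)) u
  have hker : ∀ u, A u = 0 → u = 0 := fun u hu => by rw [← hinv u, hu, map_zero]
  have hlin (a b : ℝ) : A (a, b) = a • A (1, 0) + b • A (0, 1) := by
    rw [← map_smul, ← map_smul, ← map_add]; simp
  intro hdet
  have h1 := hker ((A (0, 1)).1, -(A (1, 0)).1) <| by
    rw [hlin]
    ext <;> simp <;> linarith
  have h2 := hker ((A (0, 1)).2, -(A (1, 0)).2) <| by
    rw [hlin]
    ext <;> simp <;> linarith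
  simp only [Prod.mk_eq_zero, neg_eq_zero] at h1 h2
  have h3 := hker (1, 0) (Prod.ext h1.2 h2.2)
  simp at h3

/-- Along a line through the origin, a map fixing the origin has difference quotient
its directional derivative. -/
lemma tendsto_inv_smul_comp_line {Φ : ℝ × ℝ → ℝ × ℝ} (hΦ : Differentiable ℝ Φ) (h0 : Φ 0 = 0)
    (e : ℝ × ℝ) :
    Tendsto (fun t : ℝ => t⁻¹ • Φ (t • e)) (𝓝[≠] 0) (𝓝 (fderiv ℝ Φ 0 e)) := by
  have h := hasDerivAt_iff_tendsto_slope_zero.1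
    ((hΦ 0).hasFDerivAt.hasLineDerivAt e)
  simpa [h0] using h

/-- A differentiable map sending the line spanned by `e` to the cross has, at the origin, a
directional derivative tangent to the cross. -/
lemma mul_add_mul_eq_zero_of_line_mem_crossZ {Φ : ℝ × ℝ → ℝ × ℝ} (hΦ : Differentiable ℝ Φ)
    {e : ℝ × ℝ} (he : ∀ t : ℝ, Φ (t • e) ∈ crossZ) :
    (fderiv ℝ Φ 0 e).1 * (Φ 0).2 + (Φ 0).1 * (fderiv ℝ Φ 0 e).2 = 0 := by
  have h : HasDerivAt (fun t : ℝ => Φ (t • e)) (fderiv ℝ Φ 0 e) 0 := by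
    simpa [HasLineDerivAt] using (hΦ 0).hasFDerivAt.hasLineDerivAt e
  have hfst : HasDerivAt (fun t : ℝ => (Φ (t • e)).1) (fderiv ℝ Φ 0 e).1 0 :=
    (ContinuousLinearMap.fst ℝ ℝ ℝ).hasFDerivAt.comp_hasDerivAt 0 h
  have hsnd : HasDerivAt (fun t : ℝ => (Φ (t • e)).2) (fderiv ℝ Φ 0 e).2 0 :=
    (ContinuousLinearMap.snd ℝ ℝ ℝ).hasFDerivAt.comp_hasDerivAt 0 h
  have h12 := hfst.mul hsnd
  have hzero : ((fun t : ℝ => (Φ (t • e)).1) * fun t : ℝ => (Φ (t • e)).2) = fun _ => 0 :=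
    funext fun t => mul_eq_zero.2 (he t)
  rw [hzero] at h12
  simpa using h12.unique (hasDerivAt_const 0 0)

lemma mul_eq_zero_of_line_mem_crossZ {Φ : ℝ × ℝ → ℝ × ℝ} (hΦ : Differentiable ℝ Φ)
    (h0 : Φ 0 = 0) {e : ℝ × ℝ} (he : ∀ t : ℝ, Φ (t • e) ∈ crossZ) :
    (fderiv ℝ Φ 0 e).1 * (fderiv ℝ Φ 0 e).2 = 0 := by
  have h := tendsto_inv_smul_comp_line hΦ h0 e
  refine tendsto_nhds_unique (h.fst_nhds.mul h.snd_nhds) (tendsto_const_nhds.congr fun t => ?_)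
  have := mul_eq_zero.2 (he t)
  simp only [Prod.smul_fst, Prod.smul_snd, smul_eq_mul]
  rw [mul_mul_mul_comm, this, mul_zero]

/-- A diffeomorphism of the plane preserving the cross and pulling `ω_{k'}` back to `ω_k` forces
`k = k'`. -/
lemma eq_of_pullback_eq {k k' : ℝ} (hk : 0 < k) (hk' : 0 < k') {Φ Ψ : ℝ × ℝ → ℝ × ℝ}
    (hΦ : ContDiff ℝ (⊤ : ℕ∞) Φ) (hΨ : ContDiff ℝ (⊤ : ℕ∞) Ψ) (hleft : ∀ z, Ψ (Φ z) = z)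
    (hZ : Φ ⁻¹' crossZ = crossZ)
    (hpull : ∀ z : ℝ × ℝ, z.1 ≠ 0 → z.2 ≠ 0 →
      k' / ((Φ z).1 * (Φ z).2) *
          ((fderiv ℝ Φ z (1, 0)).1 * (fderiv ℝ Φ z (0, 1)).2
            - (fderiv ℝ Φ z (1, 0)).2 * (fderiv ℝ Φ z (0, 1)).1)
        = k / (z.1 * z.2)) : k = k' := by
  have hdΦ : Differentiable ℝ Φ := hΦ.differentiable (by simp)
  have hdet := jacobian_ne_zero_of_leftInverse hdΦ (hΨ.differentiable (by simp)) hleft 0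
  have hmem (z : ℝ × ℝ) : Φ z ∈ crossZ ↔ z ∈ crossZ := by rw [← Set.mem_preimage, hZ]
  have hx (t : ℝ) : Φ (t • ((1, 0) : ℝ × ℝ)) ∈ crossZ := (hmem _).2 (Or.inr (by simp))
  have hy (t : ℝ) : Φ (t • ((0, 1) : ℝ × ℝ)) ∈ crossZ := (hmem _).2 (Or.inl (by simp))
  have hx0 := mul_add_mul_eq_zero_of_line_mem_crossZ hdΦ hx
  have hy0 := mul_add_mul_eq_zero_of_line_mem_crossZ hdΦ hy
  have h0 : Φ 0 = 0 := by
    refine Prod.ext ?_ ?_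
    · refine (mul_eq_zero.1 ?_).resolve_left hdet
      linear_combination (fderiv ℝ Φ 0 (1, 0)).1 * hy0 - (fderiv ℝ Φ 0 (0, 1)).1 * hx0
    · refine (mul_eq_zero.1 ?_).resolve_left hdet
      linear_combination (fderiv ℝ Φ 0 (0, 1)).2 * hx0 - (fderiv ℝ Φ 0 (1, 0)).2 * hy0
  have hv := mul_eq_zero_of_line_mem_crossZ hdΦ h0 hx
  have hw := mul_eq_zero_of_line_mem_crossZ hdΦ h0 hy
  have hdiag := tendsto_inv_smul_comp_line hdΦ h0 (1, 1)
  have hsum : fderiv ℝ Φ 0 (1, 1) = fderiv ℝ Φ 0 (1, 0) + fderiv ℝ Φ 0 (0, 1) := by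
    rw [← map_add]; simp
  rw [hsum] at hdiag
  have hJ : Continuous fun t : ℝ =>
      (fderiv ℝ Φ (t • (1, 1)) (1, 0)).1 * (fderiv ℝ Φ (t • (1, 1)) (0, 1)).2
        - (fderiv ℝ Φ (t • (1, 1)) (1, 0)).2 * (fderiv ℝ Φ (t • (1, 1)) (0, 1)).1 := by
    have hc : Continuous (fderiv ℝ Φ) := hΦ.continuous_fderiv (by simp)
    fun_prop
  have hJ0 := ((hJ.tendsto 0).mono_left (nhdsWithin_le_nhds (s := {0}ᶜ))).const_mul k'
  rw [zero_smul] at hJ0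
  have hlim := (hdiag.fst_nhds.mul hdiag.snd_nhds).const_mul k
  have heq := tendsto_nhds_unique_of_eventuallyEq hJ0 hlim <| by
    filter_upwards [self_mem_nhdsWithin] with t ht
    have ht0 : t ≠ 0 := ht
    have hne : ¬ Φ (t • (1, 1)) ∈ crossZ := by
      rw [hmem]
      simp [crossZ, ht0]
    obtain ⟨h1, h2⟩ := not_or.1 hne
    have hp := hpull (t • (1, 1)) (by simpa using ht0) (by simpa using ht0)
    simp only [Prod.smul_fst, Prod.smul_snd, smul_eq_mul, mul_one] at hp ⊢
    rw [div_mul_eq_mul_div, div_eq_div_iff (mul_ne_zero h1 h2) (mul_ne_zero ht0 ht0)] at hp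
    field_simp
    linear_combination hp
  simp only [Prod.fst_add, Prod.snd_add] at heq
  generalize fderiv ℝ Φ 0 (1, 0) = v at *
  generalize fderiv ℝ Φ 0 (0, 1) = w at *
  have hcases : (v.2 = 0 ∧ w.1 = 0) ∨ (v.1 = 0 ∧ w.2 = 0) := by
    rcases mul_eq_zero.1 hv with h | h <;> rcases mul_eq_zero.1 hw with h' | h' <;> simp_all
  rcases hcases with ⟨h, h'⟩ | ⟨h, h'⟩
  · rw [h, h'] at hdet heq
    refine mul_right_cancel₀ hdet ?_
    linear_combination -heq
  · rw [h, h'] at hdet heq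
    have hsumk : (k + k') * (0 * 0 - v.2 * w.1) = 0 := by linear_combination heq
    rcases mul_eq_zero.1 hsumk with hs | hs
    · linarith
    · exact absurd hs hdet

/-- the principal-value functional of `ω_k = k (dx/x)∧(dy/y)` on bump
test functions `φ ≡ 1` near `0` determines `k`; consequently for `k ≠ k'` there is
no diffeomorphism of `ℝ²` preserving the coordinate cross `Z` pulling `ω_{k'}` back
to `ω_k` (the pullback identity being `k'/(Φ₁Φ₂) · det DΦ = k/(xy)` off `Z`). -/
theorem stmt16 (k k' : ℝ) (hk : 0 < k) (hk' : 0 < k') :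
    ((∀ φ : ℝ × ℝ → ℝ, ContDiff ℝ (⊤ : ℕ∞) φ → HasCompactSupport φ →
        (∀ᶠ z in nhds (0 : ℝ × ℝ), φ z = 1) →
        ∀ L : ℝ,
          Filter.Tendsto (pvPairing k φ) (nhdsWithin (0 : ℝ) (Set.Ioi 0)) (nhds L) →
          Filter.Tendsto (pvPairing k' φ) (nhdsWithin (0 : ℝ) (Set.Ioi 0)) (nhds L)) →
      k = k') ∧
    (k ≠ k' →
      ¬ ∃ Φ Ψ : ℝ × ℝ → ℝ × ℝ, ContDiff ℝ (⊤ : ℕ∞) Φ ∧ ContDiff ℝ (⊤ : ℕ∞) Ψ ∧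
        (∀ z, Ψ (Φ z) = z) ∧ (∀ z, Φ (Ψ z) = z) ∧
        Φ ⁻¹' crossZ = crossZ ∧
        ∀ z : ℝ × ℝ, z.1 ≠ 0 → z.2 ≠ 0 →
          k' / ((Φ z).1 * (Φ z).2) *
              ((fderiv ℝ Φ z (1, 0)).1 * (fderiv ℝ Φ z (0, 1)).2
                - (fderiv ℝ Φ z (1, 0)).2 * (fderiv ℝ Φ z (0, 1)).1)
            = k / (z.1 * z.2)) := by
  refine ⟨fun H => ?_, ?_⟩
  · obtain ⟨φ, c, hφ, hφc, hφ1, hc, hlim⟩ := exists_bump_tendsto_pvPairing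
    exact mul_right_cancel₀ hc
      (tendsto_nhds_unique (H φ hφ hφc hφ1 _ (hlim k)) (hlim k'))
  · rintro hne ⟨Φ, Ψ, hΦ, hΨ, hleft, -, hZ, hpull⟩
    exact hne (eq_of_pullback_eq hk hk' hΦ hΨ hleft hZ hpull)
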